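/- Let φ : ℝ^d → ℝ^d be an infinitely differentiable map with compact support, not identically zero, and set ε₀ = 1 / sup_{y ∈ ℝ^d} ‖Dφ(y)‖ (so 0 < ε₀ ≤ ∞; assume Dφ is not identically zero so that ε₀ < ∞). Define ξ(y, ε) = y + ε φ(y). Then for every ε with |ε| < ε₀ the map ξ(·, ε) is a bijection of ℝ^d; denoting its inverse by η(·, ε), the map (x, ε) ↦ η(x, ε) is infinitely differentiable on ℝ^d × (−ε₀, ε₀), and for all (x, ε) in this set, ∂η/∂ε(x, ε) = −(I_d + ε Dφ(η(x, ε)))^{-1} φ(η(x, ε)); in particular ∂η/∂ε(x, 0) = −φ(x) for all x ∈ ℝ^d. -/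

import Mathlib

open Function Filter Topology

section PerturbationOfIdentity

variable {E : Type*} [NormedAddCommGroup E] [NormedSpace ℝ E]

/-- A perturbation of the identity by a strict contraction is bijective. -/
theorem LipschitzWith.bijective_id_add_smul [CompleteSpace E] {φ : E → E} {K : NNReal}
    (hφ : LipschitzWith K φ) {ε : ℝ} (hε : |ε| * K < 1) :
    Bijective fun y => y + ε • φ y := by
  rw [bijective_iff_existsUnique]
  intro x
  have hc : ContractingWith (‖ε‖₊ * K) fun y => x - ε • φ y := by
    refine ⟨by rw [← NNReal.coe_lt_coe]; simpa using hε, LipschitzWith.of_dist_le_mul ?_⟩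
    intro y z
    rw [dist_sub_left, dist_smul₀, NNReal.coe_mul, coe_nnnorm, mul_assoc]
    exact mul_le_mul_of_nonneg_left (hφ.dist_le_mul y z) (norm_nonneg ε)
  refine ⟨hc.fixedPoint _, ?_, fun y hy => hc.fixedPoint_unique ?_⟩
  · have h := hc.fixedPoint_isFixedPt
    exact eq_sub_iff_add_eq.mp h.eq.symm
  · exact (eq_sub_iff_add_eq.mpr hy).symm

/-- The derivative `1 + ε A` of a perturbation of the identity is invertible for small `ε`. -/
theorem ContinuousLinearMap.isUnit_id_add_smul [CompleteSpace E] {A : E →L[ℝ] E} {ε : ℝ}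
    (hA : |ε| * ‖A‖ < 1) :
    IsUnit (ContinuousLinearMap.id ℝ E + ε • A) := by
  have h : ‖-(ε • A)‖ < 1 := by rwa [norm_neg, norm_smul, Real.norm_eq_abs]
  have h' := isUnit_one_sub_of_norm_lt_one h
  rwa [sub_neg_eq_add] at h'

/-- Fibrewise inverses of `y ↦ y + ε φ y` depend smoothly on the point and on `ε`. -/
theorem contDiffAt_inverse_id_add_smul [CompleteSpace E] {φ : E → E} {n : WithTop ℕ∞}
    (hn : n ≠ 0) (hφ : ContDiff ℝ n φ) {η : E → ℝ → E} {x : E} {ε : ℝ}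
    (hleft : ∀ᶠ e in 𝓝 ε, LeftInverse (η · e) fun y => y + e • φ y)
    (hright : η x ε + ε • φ (η x ε) = x)
    (hunit : IsUnit (ContinuousLinearMap.id ℝ E + ε • fderiv ℝ φ (η x ε))) :
    ContDiffAt ℝ n (fun p : E × ℝ => η p.1 p.2) (x, ε) := by
  obtain ⟨u, hu⟩ := hunit
  let G : ℝ × E → ℝ × E := fun p => (p.1, p.2 + p.1 • φ p.2)
  let G' : (ℝ × E) ≃L[ℝ] (ℝ × E) :=
    (ContinuousLinearEquiv.refl ℝ ℝ).skewProd (ContinuousLinearEquiv.ofUnit u)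
      (ContinuousLinearMap.toSpanSingleton ℝ (φ (η x ε)))
  have hG : ContDiffAt ℝ n G (ε, η x ε) := by
    have : ContDiff ℝ n G := by fun_prop
    exact this.contDiffAt
  have hG' : HasFDerivAt G (G' : (ℝ × E) →L[ℝ] (ℝ × E)) (ε, η x ε) := by
    have hφ' : HasFDerivAt φ (fderiv ℝ φ (η x ε)) (η x ε) :=
      (hφ.differentiable hn _).hasFDerivAt
    have hfst : HasFDerivAt (Prod.fst : ℝ × E → ℝ) (ContinuousLinearMap.fst ℝ ℝ E) (ε, η x ε) :=
      hasFDerivAt_fst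
    have hsnd : HasFDerivAt (Prod.snd : ℝ × E → E) (ContinuousLinearMap.snd ℝ ℝ E) (ε, η x ε) :=
      hasFDerivAt_snd
    have hcomp : HasFDerivAt (fun p : ℝ × E => φ p.2)
        ((fderiv ℝ φ (η x ε)).comp (ContinuousLinearMap.snd ℝ ℝ E)) (ε, η x ε) :=
      hφ'.comp (ε, η x ε) hsnd
    refine (hfst.prodMk (hsnd.add (hfst.smul hcomp))).congr_fderiv ?_
    have hu' (v : E) : (u : E →L[ℝ] E) v = v + ε • fderiv ℝ φ (η x ε) v := by
      rw [hu]; rfl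
    refine ContinuousLinearMap.ext fun p => Prod.ext rfl ?_
    change p.2 + (ε • fderiv ℝ φ (η x ε) p.2 + p.1 • φ (η x ε)) =
      (u : E →L[ℝ] E) p.2 + p.1 • φ (η x ε)
    rw [hu', add_assoc]
  have hGx : G (ε, η x ε) = (ε, x) := Prod.ext rfl hright
  have hloc : ContDiffAt ℝ n (hG.localInverse hG' hn) (ε, x) := by
    rw [← hGx]; exact hG.to_localInverse hG' hn
  have hinv : ∀ᶠ q in 𝓝 (ε, x), G (hG.localInverse hG' hn q) = q := by
    rw [← hGx]
    exact (hG.hasStrictFDerivAt' hG' hn).eventually_right_inverse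
  have hswap : Tendsto (Prod.swap : E × ℝ → ℝ × E) (𝓝 (x, ε)) (𝓝 (ε, x)) :=
    continuous_swap.tendsto (x, ε)
  have hsnd : ContDiffAt ℝ n
      (fun p : E × ℝ => (hG.localInverse hG' hn (p.2, p.1)).2) (x, ε) :=
    (hloc.comp (x, ε) (contDiff_snd.prodMk contDiff_fst).contDiffAt).snd
  refine hsnd.congr_of_eventuallyEq ?_
  filter_upwards [hswap.eventually hinv, (continuous_snd.tendsto (x, ε)).eventually hleft]
    with p hp hpl
  have h1 := congrArg Prod.fst hp
  have h2 := congrArg Prod.snd hp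
  simp only [G, Prod.swap] at h1 h2
  rw [h1] at h2
  simpa only [h2] using hpl (hG.localInverse hG' hn (p.2, p.1)).2

/-- The parameter derivative of a differentiable family of right inverses of
`y ↦ y + ε φ y`. -/
theorem hasDerivAt_inverse_id_add_smul {φ : E → E} {η : ℝ → E} {x : E} {ε : ℝ}
    (hφ : DifferentiableAt ℝ φ (η ε)) (hη : DifferentiableAt ℝ η ε)
    (hright : ∀ᶠ e in 𝓝 ε, η e + e • φ (η e) = x)
    (hunit : IsUnit (ContinuousLinearMap.id ℝ E + ε • fderiv ℝ φ (η ε))) :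
    HasDerivAt η
      (-(Ring.inverse (ContinuousLinearMap.id ℝ E + ε • fderiv ℝ φ (η ε)) (φ (η ε)))) ε := by
  have hd := hη.hasDerivAt
  have hsum := hd.add ((hasDerivAt_id ε).smul (hφ.hasFDerivAt.comp_hasDerivAt ε hd))
  have hzero := hsum.unique ((hasDerivAt_const ε x).congr_of_eventuallyEq hright)
  have hlin : (ContinuousLinearMap.id ℝ E + ε • fderiv ℝ φ (η ε)) (deriv η ε) = -φ (η ε) := by
    rw [eq_neg_iff_add_eq_zero, ← hzero]
    simp [add_assoc]
  have hinv := congrArg (fun B : E →L[ℝ] E => B (deriv η ε)) (Ring.inverse_mul_cancel _ hunit)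
  rw [← map_neg, ← hlin]
  exact hd.congr_deriv hinv.symm

end PerturbationOfIdentity


/-- Let `φ : ℝ^d → ℝ^d` be infinitely differentiable with compact support, with `Dφ` not
identically zero, and set `ε₀ = 1 / sup_y ‖Dφ(y)‖`. Then for `|ε| < ε₀` the map
`ξ(·,ε) : y ↦ y + ε φ(y)` is a bijection of `ℝ^d`; its inverse `η(·,ε)` depends infinitely
differentiably on `(x, ε) ∈ ℝ^d × (−ε₀, ε₀)`, and
`∂η/∂ε(x,ε) = −(I + ε Dφ(η(x,ε)))⁻¹ φ(η(x,ε))`; in particular `∂η/∂ε(x,0) = −φ(x)`. -/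
theorem smooth_perturbation_inverse_derivative
    (d : ℕ) (φ : EuclideanSpace ℝ (Fin d) → EuclideanSpace ℝ (Fin d))
    (hφ : ContDiff ℝ (⊤ : ℕ∞) φ) (hsupp : HasCompactSupport φ)
    (hD : 0 < ⨆ y : EuclideanSpace ℝ (Fin d), ‖fderiv ℝ φ y‖) :
    (∀ ε : ℝ, |ε| < 1 / (⨆ y : EuclideanSpace ℝ (Fin d), ‖fderiv ℝ φ y‖) →
      Function.Bijective (fun y : EuclideanSpace ℝ (Fin d) => y + ε • φ y)) ∧
    ∃ η : EuclideanSpace ℝ (Fin d) → ℝ → EuclideanSpace ℝ (Fin d),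
      (∀ ε : ℝ, |ε| < 1 / (⨆ y : EuclideanSpace ℝ (Fin d), ‖fderiv ℝ φ y‖) →
        Function.LeftInverse (fun x => η x ε)
          (fun y : EuclideanSpace ℝ (Fin d) => y + ε • φ y) ∧
        Function.RightInverse (fun x => η x ε)
          (fun y : EuclideanSpace ℝ (Fin d) => y + ε • φ y)) ∧
      ContDiffOn ℝ (⊤ : ℕ∞) (fun p : EuclideanSpace ℝ (Fin d) × ℝ => η p.1 p.2)
        (Set.univ ×ˢ Set.Ioo (-(1 / (⨆ y : EuclideanSpace ℝ (Fin d), ‖fderiv ℝ φ y‖)))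
          (1 / (⨆ y : EuclideanSpace ℝ (Fin d), ‖fderiv ℝ φ y‖))) ∧
      (∀ x : EuclideanSpace ℝ (Fin d), ∀ ε : ℝ,
        |ε| < 1 / (⨆ y : EuclideanSpace ℝ (Fin d), ‖fderiv ℝ φ y‖) →
        HasDerivAt (fun e : ℝ => η x e)
          (-(Ring.inverse
              (ContinuousLinearMap.id ℝ (EuclideanSpace ℝ (Fin d)) +
                ε • fderiv ℝ φ (η x ε)) (φ (η x ε)))) ε) ∧
      (∀ x : EuclideanSpace ℝ (Fin d), HasDerivAt (fun e : ℝ => η x e) (-φ x) 0) := by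
  set K := ⨆ y : EuclideanSpace ℝ (Fin d), ‖fderiv ℝ φ y‖
  have htop : ((⊤ : ℕ∞) : WithTop ℕ∞) ≠ 0 := by simp
  have hbdd : BddAbove (Set.range fun y => ‖fderiv ℝ φ y‖) :=
    (hφ.continuous_fderiv htop).norm.bddAbove_range_of_hasCompactSupport
      (hsupp.fderiv (𝕜 := ℝ)).norm
  have hle (y) : ‖fderiv ℝ φ y‖ ≤ K := le_ciSup hbdd y
  have hlip : LipschitzWith ⟨K, hD.le⟩ φ :=
    lipschitzWith_of_nnnorm_fderiv_le (hφ.differentiable htop) fun y => hle y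
  have hmul {ε : ℝ} (hε : |ε| < 1 / K) : |ε| * K < 1 := (lt_div_iff₀ hD).mp hε
  have hbij (ε : ℝ) (hε : |ε| < 1 / K) : Bijective fun y => y + ε • φ y :=
    hlip.bijective_id_add_smul (hmul hε)
  have hunit (ε : ℝ) (hε : |ε| < 1 / K) (y) :
      IsUnit (ContinuousLinearMap.id ℝ (EuclideanSpace ℝ (Fin d)) + ε • fderiv ℝ φ y) :=
    ContinuousLinearMap.isUnit_id_add_smul
      ((mul_le_mul_of_nonneg_left (hle y) (abs_nonneg ε)).trans_lt (hmul hε))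
  have hnhds (ε : ℝ) (hε : |ε| < 1 / K) : ∀ᶠ e in 𝓝 ε, |e| < 1 / K :=
    continuous_abs.continuousAt.eventually_lt_const hε
  let η : EuclideanSpace ℝ (Fin d) → ℝ → EuclideanSpace ℝ (Fin d) :=
    fun x ε => invFun (fun y => y + ε • φ y) x
  have hleft (ε : ℝ) (hε : |ε| < 1 / K) : LeftInverse (η · ε) fun y => y + ε • φ y :=
    leftInverse_invFun (hbij ε hε).injective
  have hright (ε : ℝ) (hε : |ε| < 1 / K) : RightInverse (η · ε) fun y => y + ε • φ y :=
    rightInverse_invFun (hbij ε hε).surjective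
  have hsmooth (x) (ε : ℝ) (hε : |ε| < 1 / K) :
      ContDiffAt ℝ (⊤ : ℕ∞) (fun p : EuclideanSpace ℝ (Fin d) × ℝ => η p.1 p.2) (x, ε) :=
    contDiffAt_inverse_id_add_smul htop hφ ((hnhds ε hε).mono hleft) (hright ε hε x)
      (hunit ε hε _)
  have hderiv (x) (ε : ℝ) (hε : |ε| < 1 / K) :
      HasDerivAt (fun e : ℝ => η x e)
        (-(Ring.inverse (ContinuousLinearMap.id ℝ (EuclideanSpace ℝ (Fin d)) +
          ε • fderiv ℝ φ (η x ε)) (φ (η x ε)))) ε := by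
    refine hasDerivAt_inverse_id_add_smul (hφ.differentiable htop _) ?_
      ((hnhds ε hε).mono fun e he => hright e he x) (hunit ε hε _)
    have hcurve : DifferentiableAt ℝ (fun e : ℝ => (x, e)) ε := by fun_prop
    exact DifferentiableAt.comp ε ((hsmooth x ε hε).differentiableAt htop) hcurve
  refine ⟨hbij, η, fun ε hε => ⟨hleft ε hε, hright ε hε⟩, ?_, hderiv, fun x => ?_⟩
  · rintro ⟨x, ε⟩ ⟨-, hε⟩
    exact (hsmooth x ε (abs_lt.mpr hε)).contDiffWithinAt
  · have hpos : |(0 : ℝ)| < 1 / K := by simpa using hD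
    have hzero : η x 0 = x := by simpa using hright 0 hpos x
    have hone : ContinuousLinearMap.id ℝ (EuclideanSpace ℝ (Fin d)) + (0 : ℝ) • fderiv ℝ φ x = 1 := by
      ext v
      simp
    have hd := hderiv x 0 hpos
    rw [hzero, hone, Ring.inverse_one] at hd
    exact hd
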